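/- Let X and E be finite-dimensional real normed spaces, f : S_X → S_E a bijective isometry, and F its positively homogeneous extension. If y ∈ S_X is a smooth point of S_X, then F is Gateaux differentiable at y. -/

import Mathlib

open Filter Topology Metric Set MeasureTheory

noncomputable section

/-- The normalized direction `v / ‖v‖` of a vector (equal to `0` when `v = 0`). -/
def unitDir {X : Type*} [NormedAddCommGroup X] [NormedSpace ℝ X] (v : X) : X := ‖v‖⁻¹ • v

/-- The set `ℷ(x)` of support functionals at a point `x` of the unit sphere:
functionals of norm one attaining the value `1` at `x`. -/
def suppFn (X : Type*) [NormedAddCommGroup X] [NormedSpace ℝ X] (x : X) :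
    Set (X →L[ℝ] ℝ) := {g | ‖g‖ = 1 ∧ g x = 1}

/-- A point of the unit sphere is smooth if it has exactly one support functional. -/
def IsSmoothPt {X : Type*} [NormedAddCommGroup X] [NormedSpace ℝ X] (x : X) : Prop :=
  ∃ g : X →L[ℝ] ℝ, suppFn X x = {g}

/-- `D_y = {x ∈ S_X : ‖x + y‖ < 2}`. -/
def Dset {X : Type*} [NormedAddCommGroup X] [NormedSpace ℝ X] (y : X) : Set X :=
  {x | x ∈ sphere (0 : X) 1 ∧ ‖x + y‖ < 2}

/-- `W_y`: points `x ∈ D_y` with `(x-y)/‖x-y‖` smooth in `X` and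
`(f x - f y)/‖f x - f y‖` smooth in `E`. -/
def Wset {X E : Type*} [NormedAddCommGroup X] [NormedSpace ℝ X]
    [NormedAddCommGroup E] [NormedSpace ℝ E] (f : X → E) (y : X) : Set X :=
  {x | x ∈ Dset y ∧ IsSmoothPt (unitDir (x - y)) ∧ IsSmoothPt (unitDir (f x - f y))}

/-- `Λ_y`: the set of limit points of `(y - z)/‖y - z‖` as `z → y`, `z ∈ S_X`, `z ≠ y`. -/
def tangentDirs {X : Type*} [NormedAddCommGroup X] [NormedSpace ℝ X] (y : X) : Set X :=
  {u | ∃ z : ℕ → X, (∀ n, z n ∈ sphere (0 : X) 1 ∧ z n ≠ y) ∧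
    Tendsto z atTop (𝓝 y) ∧ Tendsto (fun n => unitDir (y - z n)) atTop (𝓝 u)}

/-- A linear map `T` represents the tangent action of `f` at `y`: whenever `y_n → y` on the
sphere with `(y - y_n)/‖y - y_n‖ → u`, one has `(f y - f y_n)/‖f y - f y_n‖ → T u`. -/
def RepTangent {X E : Type*} [NormedAddCommGroup X] [NormedSpace ℝ X]
    [NormedAddCommGroup E] [NormedSpace ℝ E] (f : X → E) (y : X) (T : X →ₗ[ℝ] E) : Prop :=
  ∀ (z : ℕ → X) (u : X), (∀ n, z n ∈ sphere (0 : X) 1 ∧ z n ≠ y) →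
    Tendsto z atTop (𝓝 y) → Tendsto (fun n => unitDir (y - z n)) atTop (𝓝 u) →
    Tendsto (fun n => unitDir (f y - f (z n))) atTop (𝓝 (T u))

/-- The positively homogeneous extension `F` of `f`: `F 0 = 0`, `F x = ‖x‖ • f (x/‖x‖)`. -/
def homExt {X E : Type*} [NormedAddCommGroup X] [NormedSpace ℝ X]
    [NormedAddCommGroup E] [NormedSpace ℝ E] (f : X → E) (x : X) : E :=
  ‖x‖ • f (unitDir x)

/-- `F` is Gateaux differentiable at `y`: all one-sided directional derivatives exist and
depend linearly (and continuously) on the direction. -/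
def GateauxAt {X E : Type*} [NormedAddCommGroup X] [NormedSpace ℝ X]
    [NormedAddCommGroup E] [NormedSpace ℝ E] (F : X → E) (y : X) : Prop :=
  ∃ L : X →L[ℝ] E, ∀ z : X,
    Tendsto (fun a : ℝ => a⁻¹ • (F (y + a • z) - F y)) (𝓝[>] 0) (𝓝 (L z))

section NormDifferentiability

variable {K V : Type*} [NormedAddCommGroup K] [NormedSpace ℝ K]
  [NormedAddCommGroup V] [NormedSpace ℝ V]

/-- Differentiability of the norm at `e` along the range of `ι` is controlled by symmetric second
differences. -/
theorem differentiableAt_norm_add_iff (ι : K →L[ℝ] V) (e : V) :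
    DifferentiableAt ℝ (fun w => ‖e + ι w‖) 0 ↔
      ∀ ε > 0, ∃ t > 0, ∀ w : K, ‖w‖ ≤ 1 →
        ‖e + t • ι w‖ + ‖e - t • ι w‖ - 2 * ‖e‖ ≤ ε * t := by
  constructor
  · rintro ⟨L, hL⟩ ε hε
    rw [hasFDerivAt_iff_isLittleO_nhds_zero, Asymptotics.isLittleO_iff] at hL
    obtain ⟨r, hr, hball⟩ := Metric.eventually_nhds_iff.1 (hL (half_pos hε))
    refine ⟨r / 2, by positivity, fun w hw => ?_⟩
    have hnorm : ‖(r / 2) • w‖ ≤ r / 2 := by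
      rw [norm_smul, Real.norm_of_nonneg (by positivity)]
      nlinarith
    have h₁ := hball (y := (r / 2) • w) (by rw [dist_zero_right]; linarith)
    have h₂ := hball (y := -((r / 2) • w)) (by rw [dist_zero_right, norm_neg]; linarith)
    simp only [zero_add, map_zero, add_zero, map_neg, map_smul, norm_neg, Real.norm_eq_abs,
      smul_eq_mul] at h₁ h₂
    rw [← sub_eq_add_neg] at h₂
    have h₃ := (le_abs_self _).trans h₁
    have h₄ := (le_abs_self _).trans h₂
    nlinarith
  · intro h
    obtain ⟨g, hg, hge⟩ := exists_dual_vector'' ℝ e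
    have hgle : ∀ v, g v ≤ ‖v‖ := fun v =>
      (le_abs_self _).trans ((g.le_opNorm v).trans (by nlinarith [norm_nonneg v]))
    have hlow : ∀ v, g v ≤ ‖e + v‖ - ‖e‖ := fun v => by
      have := hgle (e + v)
      rw [map_add, hge] at this
      simp only [RCLike.ofReal_real_eq_id, id] at this
      linarith
    refine ⟨g.comp ι, ?_⟩
    rw [hasFDerivAt_iff_isLittleO_nhds_zero, Asymptotics.isLittleO_iff]
    intro ε hε
    obtain ⟨t, ht, hsym⟩ := h ε hε
    filter_upwards [Metric.ball_mem_nhds (0 : K) ht] with w hw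
    rw [mem_ball_zero_iff] at hw
    simp only [zero_add, map_zero, add_zero, ContinuousLinearMap.comp_apply, Real.norm_eq_abs]
    rw [abs_of_nonneg (by linarith [hlow (ι w)])]
    rcases eq_or_ne w 0 with rfl | hw0
    · simp
    have hpos : 0 < ‖w‖ := norm_pos_iff.2 hw0
    set u : K := ‖w‖⁻¹ • w with hu
    have hwu : ‖w‖ • u = w := smul_inv_smul₀ hpos.ne' w
    have h₁ := hsym u (by rw [hu, norm_smul, norm_inv, norm_norm, inv_mul_cancel₀ hpos.ne'])
    have h₂ := hlow (-(t • ι u))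
    rw [← sub_eq_add_neg, map_neg, map_smul, smul_eq_mul] at h₂
    have hconv : ‖e + ι w‖ ≤ (1 - ‖w‖ / t) * ‖e‖ + ‖w‖ / t * ‖e + t • ι u‖ := by
      have hdiv : ‖w‖ / t ≤ 1 := (div_le_one ht).2 hw.le
      have heq : e + ι w = (1 - ‖w‖ / t) • e + (‖w‖ / t) • (e + t • ι u) := by
        conv_lhs => rw [← hwu, map_smul]
        rw [smul_add, smul_smul, div_mul_cancel₀ _ ht.ne']
        module
      rw [heq]
      refine (norm_add_le _ _).trans (le_of_eq ?_)
      rw [norm_smul, norm_smul, Real.norm_of_nonneg (by linarith),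
        Real.norm_of_nonneg (by positivity)]
    have hgw : g (ι w) = ‖w‖ * g (ι u) := by
      conv_lhs => rw [← hwu, map_smul, map_smul, smul_eq_mul]
    have h₃ : ‖e + t • ι u‖ - ‖e‖ ≤ t * (ε + g (ι u)) := by linarith
    have h₄ := mul_le_mul_of_nonneg_left h₃ (by positivity : 0 ≤ ‖w‖ / t)
    have h₅ : ‖w‖ / t * (t * (ε + g (ι u))) = ‖w‖ * (ε + g (ι u)) := by field_simp
    rw [hgw]
    linarith

theorem isGδ_setOf_differentiableAt_norm_add (ι : K →L[ℝ] V) :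
    IsGδ {e : V | DifferentiableAt ℝ (fun w => ‖e + ι w‖) 0} := by
  let U : ℕ → Set V := fun n => {e | ∃ t > 0, ∃ η < 1 / ((n : ℝ) + 1), ∀ w : K, ‖w‖ ≤ 1 →
    ‖e + t • ι w‖ + ‖e - t • ι w‖ - 2 * ‖e‖ ≤ η * t}
  have hU : {e : V | DifferentiableAt ℝ (fun w => ‖e + ι w‖) 0} = ⋂ n, U n := by
    ext e
    simp only [mem_ofPred_eq, mem_iInter, differentiableAt_norm_add_iff, U]
    constructor
    · intro h n
      have hn : (0 : ℝ) < 1 / ((n : ℝ) + 1) := by positivity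
      obtain ⟨t, ht, hsym⟩ := h _ (half_pos hn)
      exact ⟨t, ht, _, half_lt_self hn, hsym⟩
    · intro h ε hε
      obtain ⟨n, hn⟩ := exists_nat_one_div_lt hε
      obtain ⟨t, ht, η, hη, hsym⟩ := h n
      refine ⟨t, ht, fun w hw => (hsym w hw).trans ?_⟩
      gcongr
      linarith
  rw [hU]
  refine IsGδ.iInter_of_isOpen fun n => Metric.isOpen_iff.2 ?_
  rintro e ⟨t, ht, η, hη, hsym⟩
  have hgap : 0 < 1 / ((n : ℝ) + 1) - η := sub_pos.2 hη
  refine ⟨(1 / ((n : ℝ) + 1) - η) * t / 8, by positivity, fun e' he' =>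
    ⟨t, ht, (1 / ((n : ℝ) + 1) + η) / 2, by linarith, fun w hw => ?_⟩⟩
  rw [mem_ball, dist_eq_norm] at he'
  have h₁ : ‖e' + t • ι w‖ ≤ ‖e + t • ι w‖ + ‖e' - e‖ := by
    refine le_of_eq_of_le ?_ (norm_add_le _ _)
    congr 1; abel
  have h₂ : ‖e' - t • ι w‖ ≤ ‖e - t • ι w‖ + ‖e' - e‖ := by
    refine le_of_eq_of_le ?_ (norm_add_le _ _)
    congr 1; abel
  have h₃ : ‖e‖ ≤ ‖e'‖ + ‖e' - e‖ := by
    rw [norm_sub_rev]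
    refine le_of_eq_of_le ?_ (norm_add_le _ _)
    congr 1; abel
  have h₄ := hsym w hw
  nlinarith

theorem isGδ_setOf_differentiableAt_norm : IsGδ {e : V | DifferentiableAt ℝ (‖·‖) e} := by
  have h := isGδ_setOf_differentiableAt_norm_add (ContinuousLinearMap.id ℝ V)
  have hiff : ∀ e : V, DifferentiableAt ℝ (fun w => ‖e + ContinuousLinearMap.id ℝ V w‖) 0 ↔
      DifferentiableAt ℝ (‖·‖) e := fun e => by
    simpa using differentiableAt_comp_add_left (𝕜 := ℝ) (f := fun v : V => ‖v‖) (x := 0) e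
  simpa only [hiff] using h

theorem DifferentiableAt.norm_add_clm {e : V} (h : DifferentiableAt ℝ (‖·‖) e) (ι : K →L[ℝ] V) :
    DifferentiableAt ℝ (fun w => ‖e + ι w‖) 0 :=
  DifferentiableAt.comp (f := fun w => e + ι w) (g := fun v : V => ‖v‖) 0 (by simpa using h)
    (ι.differentiableAt.const_add e)

/-- If the derivative of the norm at `e` vanishes on `v`, then `e` minimizes the norm on the line
`e + ℝ v`. -/
theorem HasFDerivAt.norm_le_norm_add_of_apply_eq_zero {e v : V} {h : V →L[ℝ] ℝ}
    (hh : HasFDerivAt (‖·‖) h e) (hv : h v = 0) : ‖e‖ ≤ ‖e + v‖ := by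
  have hconv : ConvexOn ℝ univ fun t : ℝ => ‖e + t • v‖ := by
    have := (convexOn_univ_norm (E := V)).comp_affineMap (AffineMap.lineMap e (e + v) : ℝ →ᵃ[ℝ] V)
    refine this.congr fun t _ => ?_
    simp [AffineMap.lineMap_apply, add_comm]
  have hder : HasDerivAt (fun t : ℝ => ‖e + t • v‖) 0 0 := by
    have h₁ : HasDerivAt (fun t : ℝ => e + t • v) v 0 := by
      simpa using ((hasDerivAt_id (0 : ℝ)).smul_const v).const_add e
    have h₂ : HasFDerivAt (‖·‖) h (e + (0 : ℝ) • v) := by simpa using hh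
    simpa [hv, Function.comp_def] using h₂.comp_hasDerivAt 0 h₁
  have := hconv.le_slope_of_hasDerivAt (mem_univ 0) (mem_univ 1) zero_lt_one hder
  simpa [slope] using this

end NormDifferentiability

section Sphere

variable {V : Type*} [NormedAddCommGroup V] [NormedSpace ℝ V]

theorem norm_smul_add_smul_lt_one {a b : V} (ha : ‖a‖ < 1) (hb : ‖b‖ ≤ 1) {s : ℝ} (hs : 0 < s)
    (hs₁ : s ≤ 1) : ‖s • a + (1 - s) • b‖ < 1 := by
  refine (norm_add_le _ _).trans_lt ?_
  rw [norm_smul, norm_smul, Real.norm_of_nonneg hs.le, Real.norm_of_nonneg (by linarith)]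
  nlinarith

theorem norm_add_smul_lt_one_of_mem_Ioo {p e : V} (hp : ‖p‖ ≤ 1) {r s t : ℝ} (hr : 0 < r)
    (hrt : ‖p + r • e‖ < 1) (ht : ‖p + t • e‖ ≤ 1) (hs : 0 < s) (hst : s < t) :
    ‖p + s • e‖ < 1 := by
  rcases le_total s r with h | h
  · have := norm_smul_add_smul_lt_one hrt hp (div_pos hs hr) ((div_le_one hr).2 h)
    convert this using 2
    rw [smul_add, smul_smul, div_mul_cancel₀ _ hr.ne']
    module
  · have hrt' : 0 < t - r := by linarith
    have := norm_smul_add_smul_lt_one hrt ht (div_pos (sub_pos.2 hst) hrt')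
      ((div_le_one hrt').2 (by linarith))
    convert this using 2
    have hcoef : (t - s) / (t - r) * r + (1 - (t - s) / (t - r)) * t = s := by
      field_simp
      ring
    calc p + s • e = p + ((t - s) / (t - r) * r + (1 - (t - s) / (t - r)) * t) • e := by
          rw [hcoef]
      _ = _ := by module

/-- Near a point `x₀` of the sphere whose chord to `p` meets the open ball, there are points `x`
of the sphere such that the norm is differentiable at `p - x`. -/
theorem exists_mem_sphere_differentiableAt_norm_sub [FiniteDimensional ℝ V] {p x₀ : V}
    (hp : p ∈ sphere (0 : V) 1) (hx₀ : x₀ ∈ sphere (0 : V) 1) (hlt : ‖x₀ + p‖ < 2)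
    {ε : ℝ} (hε : 0 < ε) :
    ∃ x ∈ sphere (0 : V) 1, ‖x - x₀‖ < ε ∧ DifferentiableAt ℝ (‖·‖) (p - x) := by
  rw [mem_sphere_zero_iff_norm] at hp hx₀
  set e := x₀ - p with he
  have hmid : ‖p + (1 / 2 : ℝ) • e‖ < 1 := by
    have : p + (1 / 2 : ℝ) • e = (1 / 2 : ℝ) • (x₀ + p) := by rw [he]; module
    rw [this, norm_smul, Real.norm_of_nonneg (by norm_num)]
    linarith
  have hone : ‖p + (1 : ℝ) • e‖ = 1 := by simpa [he] using hx₀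
  set δ : ℝ := min (1 / 2) (ε / 6) with hδ
  have hδ0 : 0 < δ := by positivity
  have hδ₁ : δ ≤ 1 / 2 := min_le_left _ _
  have hδ₂ : δ ≤ ε / 6 := min_le_right _ _
  have hlow : ‖p + (1 - δ) • e‖ < 1 :=
    norm_add_smul_lt_one_of_mem_Ioo hp.le (by norm_num) hmid hone.le (by linarith) (by linarith)
  have hhigh : 1 < ‖p + (1 + δ) • e‖ := by
    by_contra! h
    exact (norm_add_smul_lt_one_of_mem_Ioo hp.le (by norm_num) hmid h one_pos
      (by linarith)).ne hone
  have hen : ‖e‖ < 3 := by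
    have := norm_sub_le x₀ p
    rw [he]; linarith
  have hcont : ∀ s : ℝ, Continuous fun v : V => ‖p + s • v‖ := fun s => by fun_prop
  have hopen : IsOpen {v : V | ‖p + (1 - δ) • v‖ < 1 ∧ 1 < ‖p + (1 + δ) • v‖ ∧ ‖v‖ < 3 ∧
      ‖v - e‖ < ε / 2} :=
    ((isOpen_lt (hcont _) continuous_const).inter
      ((isOpen_lt continuous_const (hcont _)).inter
      ((isOpen_lt continuous_norm continuous_const).inter
      (isOpen_lt (continuous_norm.comp (continuous_sub_right e)) continuous_const))))
  obtain ⟨v, ⟨hv₁, hv₂, hv₃, hv₄⟩, hv⟩ := (dense_differentiableAt_norm (E := V)).inter_open_nonempty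
    _ hopen ⟨e, hlow, hhigh, hen, by simpa using half_pos hε⟩
  obtain ⟨s, hs, hsv⟩ := intermediate_value_Icc (f := fun s : ℝ => ‖p + s • v‖) (a := 1 - δ)
    (b := 1 + δ) (by linarith) (by fun_prop) ⟨hv₁.le, hv₂.le⟩
  refine ⟨p + s • v, by simpa using hsv, ?_, ?_⟩
  · have heq : p + s • v - x₀ = (v - e) + (s - 1) • v := by rw [he]; module
    have hs₁ : |s - 1| ≤ δ := abs_le.2 ⟨by linarith [hs.1], by linarith [hs.2]⟩
    rw [heq]
    refine (norm_add_le _ _).trans_lt ?_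
    rw [norm_smul, Real.norm_eq_abs]
    nlinarith [norm_nonneg v, abs_nonneg (s - 1)]
  · have heq : p - (p + s • v) = (-s) • v := by module
    have hs0 : -s ≠ 0 := by
      have := hs.1
      intro h
      linarith
    rw [heq]
    exact (differentiableAt_norm_smul hs0).1 hv

/-- From `p` in the sphere, every ray entering the open ball early enough leaves the ball at a
point of the sphere. -/
theorem exists_smul_add_mem_sphere {p e : V} (hp : p ∈ sphere (0 : V) 1)
    (hlt : ‖p + (1 / 2 : ℝ) • e‖ < 1) :
    ∃ s : ℝ, 0 < s ∧ p + s • e ∈ sphere (0 : V) 1 ∧ ‖(p + s • e) + p‖ < 2 := by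
  rw [mem_sphere_zero_iff_norm] at hp
  have he : e ≠ 0 := by
    rintro rfl
    simp [hp] at hlt
  have hpos : 0 < ‖e‖ := norm_pos_iff.2 he
  have hbig : 1 ≤ ‖p + (2 / ‖e‖) • e‖ := by
    have h₁ : ‖(2 / ‖e‖) • e‖ = 2 := by
      rw [norm_smul, Real.norm_of_nonneg (by positivity), div_mul_cancel₀ _ hpos.ne']
    have h₂ := norm_sub_le (p + (2 / ‖e‖) • e) p
    rw [add_sub_cancel_left, h₁, hp] at h₂
    linarith
  have hle : 1 / 2 ≤ 2 / ‖e‖ := by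
    have h₁ : ‖(1 / 2 : ℝ) • e‖ < 2 := by
      have := norm_sub_le (p + (1 / 2 : ℝ) • e) p
      rw [add_sub_cancel_left, hp] at this
      linarith
    rw [norm_smul, Real.norm_of_nonneg (by norm_num)] at h₁
    rw [le_div_iff₀ hpos]
    linarith
  obtain ⟨s, hs, hs₁⟩ := intermediate_value_Icc (f := fun s : ℝ => ‖p + s • e‖) hle
    (by fun_prop) ⟨hlt.le, hbig⟩
  have hs₁' : ‖p + s • e‖ = 1 := hs₁
  have hs0 : 0 < s := by linarith [hs.1]
  refine ⟨s, hs0, by simpa using hs₁', ?_⟩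
  have := norm_add_smul_lt_one_of_mem_Ioo (s := s / 2) hp.le (by norm_num) hlt hs₁'.le
    (by linarith) (by linarith)
  have heq : p + s • e + p = (2 : ℝ) • (p + (s / 2) • e) := by module
  rw [heq, norm_smul, Real.norm_of_nonneg (by norm_num)]
  linarith

/-- A vector along which the norm does not decrease in any chord direction at `p` is zero. -/
theorem eq_zero_of_norm_sub_le_norm_sub_add {p v : V} (hp : p ∈ sphere (0 : V) 1)
    (h : ∀ x ∈ sphere (0 : V) 1, ‖x + p‖ < 2 → ∀ t : ℝ, ‖p - x‖ ≤ ‖p - x + t • v‖) : v = 0 := by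
  by_contra hv
  have hray : ∀ w : V, (∃ c : ℝ, w = c • v) → ‖p + w‖ = 3 / 2 → ‖w - p‖ ≤ 1 := by
    rintro _ ⟨c, rfl⟩ hc
    obtain ⟨s, hs, hsS, hslt⟩ := exists_smul_add_mem_sphere (e := c • v - p) hp (by
      have : p + (1 / 2 : ℝ) • (c • v - p) = (1 / 2 : ℝ) • (p + c • v) := by module
      rw [this, norm_smul, hc]
      norm_num)
    have := h _ hsS hslt (s * c)
    have h₁ : p - (p + s • (c • v - p)) = (-s) • (c • v - p) := by module
    have h₂ : p - (p + s • (c • v - p)) + (s * c) • v = s • p := by module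
    rw [h₂, h₁, norm_smul, norm_smul, norm_neg, mem_sphere_zero_iff_norm.1 hp] at this
    exact le_of_mul_le_mul_left this (norm_pos_iff.2 hs.ne')
  rw [mem_sphere_zero_iff_norm] at hp
  have hvpos : 0 < ‖v‖ := norm_pos_iff.2 hv
  have hivt : ∀ u : V, ‖u‖ = ‖v‖ → ∃ t : ℝ, 0 < t ∧ ‖p + t • u‖ = 3 / 2 := fun u hu => by
    have hfar : 3 / 2 ≤ ‖p + (3 / ‖v‖) • u‖ := by
      have h₁ : ‖(3 / ‖v‖) • u‖ = 3 := by
        rw [norm_smul, Real.norm_of_nonneg (by positivity), hu, div_mul_cancel₀ _ hvpos.ne']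
      have h₂ := norm_sub_le (p + (3 / ‖v‖) • u) p
      rw [add_sub_cancel_left, h₁, hp] at h₂
      linarith
    obtain ⟨t, ht, ht₁⟩ := intermediate_value_Icc (f := fun t : ℝ => ‖p + t • u‖) (a := 0)
      (by positivity : 0 ≤ 3 / ‖v‖) (by fun_prop) ⟨by simp [hp]; norm_num, hfar⟩
    refine ⟨t, lt_of_le_of_ne ht.1 ?_, ht₁⟩
    rintro rfl
    norm_num [hp] at ht₁
  have hseg : ∀ (u : V) (r s : ℝ), 0 < r → r ≤ s → ‖p + s • u‖ ≤ 1 → ‖p + r • u‖ ≤ 1 := by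
    intro u r s hr hrs hs
    have hs0 : 0 < s := hr.trans_le hrs
    have heq : p + r • u = (r / s) • (p + s • u) + (1 - r / s) • p := by
      rw [smul_add, smul_smul, div_mul_cancel₀ _ hs0.ne']
      module
    have hdiv : r / s ≤ 1 := (div_le_one hs0).2 hrs
    have hdiv0 : 0 < r / s := div_pos hr hs0
    rw [heq]
    refine (norm_add_le _ _).trans ?_
    rw [norm_smul, norm_smul, Real.norm_of_nonneg hdiv0.le, Real.norm_of_nonneg (by linarith), hp]
    nlinarith
  obtain ⟨r, hr, hr₁⟩ := hivt v rfl
  obtain ⟨s, hs, hs₁⟩ := hivt (-v) (norm_neg v)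
  have hr₂ := hray _ ⟨r, rfl⟩ hr₁
  have hs₂ := hray _ ⟨-s, by module⟩ hs₁
  rw [norm_sub_rev, sub_eq_add_neg, ← smul_neg] at hr₂
  rw [norm_sub_rev, smul_neg, sub_neg_eq_add] at hs₂
  rcases le_total r s with hrs | hsr
  · linarith [hseg v r s hr hrs hs₂]
  · linarith [hseg (-v) s r hs hsr hr₂]

end Sphere

section SmoothPoints

variable {X : Type*} [NormedAddCommGroup X] [NormedSpace ℝ X]

theorem mem_suppFn_of_norm_le_one {y : X} (hy : ‖y‖ = 1) {φ : X →L[ℝ] ℝ} (hφ : ‖φ‖ ≤ 1)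
    (hφy : φ y = 1) : φ ∈ suppFn X y := by
  refine ⟨le_antisymm hφ ?_, hφy⟩
  have := φ.le_opNorm y
  rwa [hφy, hy, norm_one, mul_one] at this

/-- At a smooth point of the sphere the unique support functional is the directional derivative
of the norm. -/
theorem tendsto_norm_add_smul_of_suppFn_eq [FiniteDimensional ℝ X] {y : X} (hy : ‖y‖ = 1)
    {g : X →L[ℝ] ℝ} (hg : suppFn X y = {g}) (z : X) :
    Tendsto (fun a : ℝ => a⁻¹ * (‖y + a • z‖ - 1)) (𝓝[>] 0) (𝓝 (g z)) := by
  have hgmem : g ∈ suppFn X y := hg ▸ mem_singleton g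
  choose φ hφn hφ using fun a : ℝ => exists_dual_vector'' ℝ (y + a • z)
  simp only [RCLike.ofReal_real_eq_id, id] at hφ
  have hle : ∀ (ψ : X →L[ℝ] ℝ), ‖ψ‖ ≤ 1 → ∀ v, ψ v ≤ ‖v‖ := fun ψ hψ v =>
    (le_abs_self _).trans ((ψ.le_opNorm v).trans (by nlinarith [norm_nonneg v]))
  have hφy : Tendsto (fun a => φ a y) (𝓝[>] 0) (𝓝 1) := by
    have hlow : Tendsto (fun a : ℝ => ‖y + a • z‖ - ‖a • z‖) (𝓝[>] 0) (𝓝 1) := by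
      refine Tendsto.mono_left ?_ nhdsWithin_le_nhds
      have : Continuous fun a : ℝ => ‖y + a • z‖ - ‖a • z‖ := by fun_prop
      simpa [hy] using this.tendsto 0
    refine tendsto_of_tendsto_of_tendsto_of_le_of_le hlow tendsto_const_nhds (fun a => ?_)
      fun a => by simpa [hy] using hle (φ a) (hφn a) y
    have h₁ := hφ a
    have h₂ := hle (φ a) (hφn a) (a • z)
    rw [map_add] at h₁
    linarith
  have hφg : Tendsto φ (𝓝[>] 0) (𝓝 g) := by
    have : ProperSpace (X →L[ℝ] ℝ) := FiniteDimensional.proper_real _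
    refine (isCompact_closedBall (0 : X →L[ℝ] ℝ) 1).tendsto_nhds_of_unique_mapClusterPt
      (Eventually.of_forall fun a => by simpa using hφn a) fun ψ hψ hcl => ?_
    have hcl' := hcl.continuousAt_comp (f := fun χ : X →L[ℝ] ℝ => χ y)
      (by fun_prop : Continuous fun χ : X →L[ℝ] ℝ => χ y).continuousAt
    have hψy : ψ y = 1 := by
      have : (𝓝 (ψ y) ⊓ 𝓝 1).NeBot := NeBot.mono hcl' (inf_le_inf_left _ hφy)
      exact eq_of_nhds_neBot this
    have : ψ ∈ suppFn X y := mem_suppFn_of_norm_le_one hy (by simpa using hψ) hψy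
    rwa [hg] at this
  have hφz : Tendsto (fun a => φ a z) (𝓝[>] 0) (𝓝 (g z)) :=
    ((by fun_prop : Continuous fun χ : X →L[ℝ] ℝ => χ z).tendsto g).comp hφg
  refine tendsto_of_tendsto_of_tendsto_of_le_of_le' tendsto_const_nhds hφz ?_ ?_
  · filter_upwards [self_mem_nhdsWithin] with a ha
    have ha : 0 < a := ha
    have := hle g hgmem.1.le (y + a • z)
    rw [map_add, map_smul, hgmem.2, smul_eq_mul] at this
    rw [le_inv_mul_iff₀ ha]
    linarith
  · filter_upwards [self_mem_nhdsWithin] with a ha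
    have ha : 0 < a := ha
    have h₁ := hφ a
    have h₂ := hle (φ a) (hφn a) y
    rw [map_add, map_smul, smul_eq_mul] at h₁
    rw [inv_mul_le_iff₀ ha]
    linarith

theorem apply_eq_one_of_norm_add_eq_two {x y : X} (hx : ‖x‖ = 1) (hy : ‖y‖ = 1)
    {g : X →L[ℝ] ℝ} (hg : suppFn X y = {g}) (hxy : ‖x + y‖ = 2) : g x = 1 := by
  obtain ⟨φ, hφn, hφ⟩ := exists_dual_vector'' ℝ (x + y)
  have hle : ∀ v, φ v ≤ ‖v‖ := fun v =>
    (le_abs_self _).trans ((φ.le_opNorm v).trans (by nlinarith [norm_nonneg v]))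
  have h₁ := hle x
  have h₂ := hle y
  rw [map_add, hxy] at hφ
  simp only [RCLike.ofReal_real_eq_id, id] at hφ
  have : φ ∈ suppFn X y := mem_suppFn_of_norm_le_one hy hφn (by linarith)
  rw [hg, mem_singleton_iff] at this
  rw [← this]
  linarith

theorem norm_unitDir {v : X} (hv : v ≠ 0) : ‖unitDir v‖ = 1 := by
  rw [unitDir, norm_smul, norm_inv, norm_norm, inv_mul_cancel₀ (norm_ne_zero_iff.2 hv)]

theorem unitDir_of_norm_eq_one {v : X} (hv : ‖v‖ = 1) : unitDir v = v := by
  simp [unitDir, hv]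

theorem continuousAt_unitDir {v : X} (hv : v ≠ 0) : ContinuousAt (unitDir (X := X)) v :=
  (continuousAt_id.norm.inv₀ (norm_ne_zero_iff.2 hv)).smul continuousAt_id

/-- For a smooth point `y` with support functional `g`, the points `x` of the sphere such that the
norm is differentiable at `y - x` along `ker g` are dense in the sphere. -/
theorem exists_mem_sphere_differentiableAt_norm_sub_add_ker [FiniteDimensional ℝ X] {y x₀ : X}
    (hy : y ∈ sphere (0 : X) 1) {g : X →L[ℝ] ℝ} (hg : suppFn X y = {g})
    (hx₀ : x₀ ∈ sphere (0 : X) 1) {ε : ℝ} (hε : 0 < ε) :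
    ∃ x ∈ sphere (0 : X) 1, ‖x - x₀‖ < ε ∧
      DifferentiableAt ℝ (fun w => ‖y - x + g.ker.subtypeL w‖) 0 := by
  have hgmem : g ∈ suppFn X y := hg ▸ mem_singleton g
  have hy₁ := mem_sphere_zero_iff_norm.1 hy
  have htrans : ∀ x₁ ∈ sphere (0 : X) 1, ‖x₁ + y‖ < 2 → ∀ η > 0, ∃ x ∈ sphere (0 : X) 1,
      ‖x - x₁‖ < η ∧ DifferentiableAt ℝ (fun w => ‖y - x + g.ker.subtypeL w‖) 0 := by
    intro x₁ hx₁ hlt η hη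
    obtain ⟨x, hx, hxx, hd⟩ := exists_mem_sphere_differentiableAt_norm_sub hy hx₁ hlt hη
    exact ⟨x, hx, hxx, hd.norm_add_clm _⟩
  rcases lt_or_ge ‖x₀ + y‖ 2 with hlt | hge
  · exact htrans x₀ hx₀ hlt ε hε
  have hx₀₁ := mem_sphere_zero_iff_norm.1 hx₀
  have hgx₀ : g x₀ = 1 := apply_eq_one_of_norm_add_eq_two hx₀₁ hy₁ hg
    (le_antisymm ((norm_add_le _ _).trans (by rw [hx₀₁, hy₁]; norm_num)) hge)
  let v₀ : g.ker := ⟨x₀ - y, by simp [hgx₀, hgmem.2]⟩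
  have hadd : y + (v₀ : X) = x₀ := add_sub_cancel y x₀
  have hx₀0 : x₀ ≠ 0 := norm_ne_zero_iff.1 (by rw [hx₀₁]; norm_num)
  have hcont : ContinuousAt (fun v : g.ker => unitDir (y + (v : X))) v₀ :=
    ContinuousAt.comp (g := unitDir (X := X)) (by rw [hadd]; exact continuousAt_unitDir hx₀0)
      (by fun_prop)
  have hnear : ∀ᶠ v : g.ker in 𝓝 v₀, ‖unitDir (y + (v : X)) - x₀‖ < ε / 2 := by
    have := Metric.continuousAt_iff'.1 hcont (ε / 2) (half_pos hε)
    simpa only [hadd, unitDir_of_norm_eq_one hx₀₁, dist_eq_norm] using this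
  obtain ⟨v, hvd, hv⟩ :=
    (dense_differentiableAt_norm (E := g.ker)).exists_mem_open isOpen_interior
      ⟨v₀, mem_interior_iff_mem_nhds.2 hnear⟩
  have hv' : ‖unitDir (y + (v : X)) - x₀‖ < ε / 2 :=
    interior_subset (s := {v : g.ker | ‖unitDir (y + (v : X)) - x₀‖ < ε / 2}) hv
  have hgv : g (y + v) = 1 := by
    have : g v = 0 := v.2
    rw [map_add, hgmem.2, this, add_zero]
  have hne : y + (v : X) ≠ 0 := fun h0 => by simp [h0] at hgv
  have hge₁ : 1 ≤ ‖y + (v : X)‖ := by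
    have := (le_abs_self _).trans (g.le_opNorm (y + v))
    rwa [hgv, hgmem.1, one_mul] at this
  rcases hge₁.eq_or_lt with heq | hlt
  · rw [unitDir_of_norm_eq_one heq.symm] at hv'
    refine ⟨y + v, by simpa using heq.symm, by linarith, ?_⟩
    have hd : DifferentiableAt ℝ (‖·‖) (-v) := by
      simpa using (differentiableAt_norm_smul (by norm_num : (-1 : ℝ) ≠ 0)).1 hvd
    have := hd.norm_add_clm (ContinuousLinearMap.id ℝ g.ker)
    have hfun : (fun w => ‖y - (y + (v : X)) + g.ker.subtypeL w‖) =
        fun w => ‖-v + ContinuousLinearMap.id ℝ g.ker w‖ := funext fun w => by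
      rw [sub_add_cancel_left]
      rfl
    rwa [hfun]
  · have hS : unitDir (y + (v : X)) ∈ sphere (0 : X) 1 := by simpa using norm_unitDir hne
    have hlt₂ : ‖unitDir (y + (v : X)) + y‖ < 2 := by
      refine lt_of_le_of_ne ((norm_add_le _ _).trans ?_) fun h2 => ?_
      · rw [norm_unitDir hne, hy₁]; norm_num
      · have := apply_eq_one_of_norm_add_eq_two (norm_unitDir hne) hy₁ hg h2
        rw [unitDir, map_smul, hgv, smul_eq_mul, mul_one, inv_eq_one] at this
        linarith
    obtain ⟨x, hx, hxx, hd⟩ := htrans _ hS hlt₂ (ε / 2) (half_pos hε)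
    refine ⟨x, hx, ?_, hd⟩
    have := norm_add_le (x - unitDir (y + (v : X))) (unitDir (y + (v : X)) - x₀)
    rw [sub_add_sub_cancel] at this
    linarith

end SmoothPoints

theorem HasFDerivAt.tendsto_inv_mul_norm_add_smul_sub {X : Type*} [NormedAddCommGroup X]
    [NormedSpace ℝ X] {K : Submodule ℝ X} {e : X} {L : K →L[ℝ] ℝ}
    (hL : HasFDerivAt (fun w => ‖e + K.subtypeL w‖) L 0) {p : ℝ → X} {w : K}
    (hp : Tendsto p (𝓝[>] 0) (𝓝 (w : X))) :
    Tendsto (fun a : ℝ => a⁻¹ * (‖e + a • p a‖ - ‖e‖)) (𝓝[>] 0) (𝓝 (L w)) := by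
  have hder : HasDerivAt (fun t : ℝ => ‖e + t • (w : X)‖) (L w) 0 := by
    have h₁ : HasDerivAt (fun t : ℝ => t • w) w 0 := by
      simpa using (hasDerivAt_id (0 : ℝ)).smul_const w
    have h₂ : HasFDerivAt (fun w => ‖e + K.subtypeL w‖) L ((0 : ℝ) • w) := by simpa using hL
    simpa [Function.comp_def] using h₂.comp_hasDerivAt 0 h₁
  have hmain := (hasDerivAt_iff_tendsto_slope_zero.1 hder).mono_left
    (nhdsWithin_mono 0 fun a (ha : 0 < a) => ha.ne')
  have herr : Tendsto (fun a : ℝ => a⁻¹ * (‖e + a • p a‖ - ‖e + a • (w : X)‖)) (𝓝[>] 0) (𝓝 0) := by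
    have hpw : Tendsto (fun a => ‖p a - w‖) (𝓝[>] 0) (𝓝 0) := by
      simpa using (hp.sub_const (w : X)).norm
    refine squeeze_zero_norm' ?_ hpw
    filter_upwards [self_mem_nhdsWithin] with a ha
    have ha : 0 < a := ha
    rw [norm_mul, norm_inv, Real.norm_of_nonneg ha.le, inv_mul_le_iff₀ ha]
    refine (abs_norm_sub_norm_le _ _).trans (le_of_eq ?_)
    rw [add_sub_add_left_eq_sub, ← smul_sub, norm_smul, Real.norm_of_nonneg ha.le]
  simpa [← mul_add] using herr.add hmain

theorem HasFDerivAt.tendsto_apply_of_tendsto_inv_mul_norm {E : Type*} [NormedAddCommGroup E]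
    [NormedSpace ℝ E] {e : E} {h : E →L[ℝ] ℝ} (hh : HasFDerivAt (‖·‖) h e) {q : ℝ → E} {r ℓ : ℝ}
    (hq : Tendsto (fun a => ‖q a‖) (𝓝[>] 0) (𝓝 r))
    (hlim : Tendsto (fun a : ℝ => a⁻¹ * (‖e + a • q a‖ - ‖e‖)) (𝓝[>] 0) (𝓝 ℓ)) :
    Tendsto (fun a => h (q a)) (𝓝[>] 0) (𝓝 ℓ) := by
  have hid : Tendsto (fun a : ℝ => a) (𝓝[>] 0) (𝓝 0) := nhdsWithin_le_nhds
  have hO : (fun a : ℝ => a • q a) =O[𝓝[>] 0] fun a : ℝ => a := by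
    have := (Asymptotics.isBigO_refl (fun a : ℝ => a) (𝓝[>] 0)).smul
      ((hq.isBigO_one ℝ).of_norm_left)
    simpa using this
  have ho := ((hasFDerivAt_iff_isLittleO_nhds_zero.1 hh).comp_tendsto
    (hO.trans_tendsto hid)).trans_isBigO hO
  have hzero := ho.tendsto_div_nhds_zero
  have := hlim.sub hzero
  rw [sub_zero] at this
  refine this.congr' ?_
  filter_upwards [self_mem_nhdsWithin] with a ha
  have ha : a ≠ 0 := (show 0 < a from ha).ne'
  simp only [Function.comp_apply, map_smul, smul_eq_mul]
  field_simp
  ring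

/-- A family of linear functionals separating points detects convergence to a linear map. -/
theorem exists_linearMap_tendsto_of_separating {R α X E : Type*} [AddCommGroup X] [Module ℝ X]
    [NormedAddCommGroup E] [NormedSpace ℝ E] [FiniteDimensional ℝ E] {l : Filter α} [l.NeBot]
    (h : R → E →L[ℝ] ℝ) (hsep : ∀ v, (∀ i, h i v = 0) → v = 0) (lam : R → X →ₗ[ℝ] ℝ)
    (q : X → α → E) (hq : ∀ z i, Tendsto (fun a => h i (q z a)) l (𝓝 (lam i z))) :
    ∃ T : X →ₗ[ℝ] E, ∀ z, Tendsto (q z) l (𝓝 (T z)) := by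
  let Φ : E →ₗ[ℝ] R → ℝ := LinearMap.pi fun i => (h i : E →ₗ[ℝ] ℝ)
  have hker : LinearMap.ker Φ = ⊥ := by
    refine LinearMap.ker_eq_bot'.2 fun v hv => hsep v fun i => ?_
    exact congrFun hv i
  have hemb := LinearMap.isClosedEmbedding_of_injective hker
  have htend : ∀ z, Tendsto (fun a => Φ (q z a)) l (𝓝 (LinearMap.pi lam z)) := fun z =>
    tendsto_pi_nhds.2 fun i => hq z i
  have hmem : ∀ z, LinearMap.pi lam z ∈ LinearMap.range Φ := fun z =>
    hemb.isClosed_range.mem_of_tendsto (htend z) (Eventually.of_forall fun a => ⟨_, rfl⟩)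
  let ΦE := LinearEquiv.ofInjective Φ (LinearMap.ker_eq_bot.1 hker)
  refine ⟨ΦE.symm.toLinearMap ∘ₗ (LinearMap.pi lam).codRestrict (LinearMap.range Φ) hmem,
    fun z => hemb.isInducing.tendsto_nhds_iff.2 ?_⟩
  have heq : Φ (ΦE.symm ⟨LinearMap.pi lam z, hmem z⟩) = LinearMap.pi lam z :=
    congrArg Subtype.val (ΦE.apply_symm_apply ⟨LinearMap.pi lam z, hmem z⟩)
  exact heq.symm ▸ htend z

theorem IsOpen.subset_closure_inter_of_isGδ {S : Type*} [TopologicalSpace S] [BaireSpace S]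
    {G Q O : Set S} (hG : IsGδ G) (hGd : Dense G) (hQ : IsGδ Q) (hO : IsOpen O)
    (hOQ : O ⊆ closure Q) : O ⊆ closure (O ∩ (G ∩ Q)) := by
  have hQ' : IsGδ (Q ∪ (closure O)ᶜ) := hQ.union isClosed_closure.isOpen_compl.isGδ
  have hQd : Dense (Q ∪ (closure O)ᶜ) := fun x => by
    rw [closure_union]
    by_cases hx : x ∈ closure O
    · exact Or.inl (closure_minimal hOQ isClosed_closure hx)
    · exact Or.inr (subset_closure hx)
  refine ((hGd.inter_of_Gδ hG hQ' hQd).open_subset_closure_inter hO).trans (closure_mono ?_)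
  rintro x ⟨hxO, hxG, hxQ | hxc⟩
  · exact ⟨hxO, hxG, hxQ⟩
  · exact absurd (subset_closure hxO) hxc

/-- For `f` an isometry of spheres and `y` smooth with support functional `g`, generic points `x`
with chord at `f y` transversal to the sphere have the norm of `X` differentiable at `y - x` along
`ker g` and the norm of `E` differentiable at `f y - f x`. -/
theorem exists_subset_sphere_differentiableAt_norm {X E : Type*} [NormedAddCommGroup X]
    [NormedSpace ℝ X] [FiniteDimensional ℝ X] [NormedAddCommGroup E] [NormedSpace ℝ E]
    [FiniteDimensional ℝ E] {f : X → E}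
    (hbij : Set.BijOn f (sphere (0 : X) 1) (sphere (0 : E) 1))
    (hiso : ∀ x ∈ sphere (0 : X) 1, ∀ x' ∈ sphere (0 : X) 1, ‖f x - f x'‖ = ‖x - x'‖)
    {y : X} (hy : y ∈ sphere (0 : X) 1) {g : X →L[ℝ] ℝ} (hg : suppFn X y = {g}) :
    ∃ R : Set (sphere (0 : X) 1),
      (∀ x ∈ R, DifferentiableAt ℝ (fun w => ‖y - x + g.ker.subtypeL w‖) 0) ∧
      (∀ x ∈ R, DifferentiableAt ℝ (‖·‖) (f y - f x)) ∧
      {x : sphere (0 : X) 1 | ‖f x + f y‖ < 2} ⊆ closure R := by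
  have : ProperSpace X := FiniteDimensional.proper_real X
  have hf : Isometry fun x : sphere (0 : X) 1 => f x := Isometry.of_dist_eq fun a b => by
    rw [dist_eq_norm, hiso _ a.2 _ b.2, ← dist_eq_norm, Subtype.dist_eq]
  let G : Set (sphere (0 : X) 1) :=
    {x | DifferentiableAt ℝ (fun w => ‖y - x + g.ker.subtypeL w‖) 0}
  let Q : Set (sphere (0 : X) 1) := {x | DifferentiableAt ℝ (‖·‖) (f y - f x)}
  have hG : IsGδ G := IsGδ.preimage (f := fun x : sphere (0 : X) 1 => y - (x : X)) (by fun_prop)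
    (isGδ_setOf_differentiableAt_norm_add g.ker.subtypeL)
  have hQ : IsGδ Q := IsGδ.preimage (f := fun x : sphere (0 : X) 1 => f y - f x)
    (continuous_const.sub hf.continuous) isGδ_setOf_differentiableAt_norm
  have hGd : Dense G := fun x₀ => Metric.mem_closure_iff.2 fun ε hε => by
    obtain ⟨x, hx, hxx, hd⟩ :=
      exists_mem_sphere_differentiableAt_norm_sub_add_ker hy hg x₀.2 hε
    refine ⟨⟨x, hx⟩, hd, ?_⟩
    rwa [dist_comm, Subtype.dist_eq, dist_eq_norm]
  have hO : IsOpen {x : sphere (0 : X) 1 | ‖f x + f y‖ < 2} :=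
    isOpen_lt (hf.continuous.add continuous_const).norm continuous_const
  have hOQ : {x : sphere (0 : X) 1 | ‖f x + f y‖ < 2} ⊆ closure Q := fun x₀ hx₀ =>
    Metric.mem_closure_iff.2 fun ε hε => by
      obtain ⟨x', hx', hxx, hd⟩ := exists_mem_sphere_differentiableAt_norm_sub
        (hbij.mapsTo hy) (hbij.mapsTo x₀.2) hx₀ hε
      obtain ⟨x, hx, rfl⟩ := hbij.surjOn hx'
      refine ⟨⟨x, hx⟩, hd, ?_⟩
      rwa [dist_comm, Subtype.dist_eq, dist_eq_norm, ← hiso _ hx _ x₀.2]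
  exact ⟨_, fun x hx => hx.2.1, fun x hx => hx.2.2,
    IsOpen.subset_closure_inter_of_isGδ hG hGd hQ hO hOQ⟩

/-- **Theorem (differentiability, case 1).** The homogeneous extension `F` of `f` is
Gateaux differentiable at every smooth point `y ∈ S_X`. -/
theorem gateaux_at_smooth {X E : Type*} [NormedAddCommGroup X] [NormedSpace ℝ X]
    [FiniteDimensional ℝ X] [NormedAddCommGroup E] [NormedSpace ℝ E] [FiniteDimensional ℝ E]
    (f : X → E) (hbij : Set.BijOn f (sphere (0 : X) 1) (sphere (0 : E) 1))
    (hiso : ∀ x ∈ sphere (0 : X) 1, ∀ x' ∈ sphere (0 : X) 1, ‖f x - f x'‖ = ‖x - x'‖)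
    (y : X) (hy : y ∈ sphere (0 : X) 1) (hysm : IsSmoothPt y) :
    GateauxAt (homExt f) y := by
  obtain ⟨g, hg⟩ := hysm
  have hgy : g y = 1 := (hg ▸ mem_singleton g : g ∈ suppFn X y).2
  have hy₁ := mem_sphere_zero_iff_norm.1 hy
  obtain ⟨R, hRX, hRE, hRcl⟩ := exists_subset_sphere_differentiableAt_norm hbij hiso hy hg
  choose L hL using fun x : R => hRX x x.2
  choose h hh using fun x : R => hRE x x.2
  have hsep : ∀ v, (∀ x, h x v = 0) → v = 0 := fun v hv => by
    refine eq_zero_of_norm_sub_le_norm_sub_add (hbij.mapsTo hy) fun x' hx' hlt t => ?_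
    obtain ⟨x, hx, rfl⟩ := hbij.surjOn hx'
    have hf : Continuous fun x : sphere (0 : X) 1 => f x :=
      (Isometry.of_dist_eq fun a b => by
        rw [dist_eq_norm, hiso _ a.2 _ b.2, ← dist_eq_norm, Subtype.dist_eq]).continuous
    have hclosed : IsClosed {x : sphere (0 : X) 1 | ‖f y - f x‖ ≤ ‖f y - f x + t • v‖} :=
      isClosed_le (continuous_const.sub hf).norm
        ((continuous_const.sub hf).add continuous_const).norm
    have hsub : R ⊆ {x : sphere (0 : X) 1 | ‖f y - f x‖ ≤ ‖f y - f x + t • v‖} := fun x hx =>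
      (hh ⟨x, hx⟩).norm_le_norm_add_of_apply_eq_zero (by rw [map_smul, hv, smul_zero])
    exact closure_minimal hsub hclosed (hRcl (show (⟨x, hx⟩ : sphere (0 : X) 1) ∈ _ from hlt))
  let P : X →ₗ[ℝ] g.ker :=
    (LinearMap.id - (g : X →ₗ[ℝ] ℝ).smulRight y).codRestrict _ fun z => by simp [hgy]
  have hP : ∀ z, (P z : X) = z - g z • y := fun z => rfl
  -- The normalized curve through `y` in direction `z` and its difference quotients.
  let c : X → ℝ → X := fun z a => unitDir (y + a • z)
  let p : X → ℝ → X := fun z a => a⁻¹ • (c z a - y)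
  let q : X → ℝ → E := fun z a => a⁻¹ • (f (c z a) - f y)
  have hy0 : y ≠ 0 := norm_ne_zero_iff.1 (by rw [hy₁]; norm_num)
  have hcurve : ∀ z, Tendsto (fun a : ℝ => y + a • z) (𝓝[>] 0) (𝓝 y) := fun z => by
    refine Tendsto.mono_left ?_ nhdsWithin_le_nhds
    have : Continuous fun a : ℝ => y + a • z := by fun_prop
    simpa using this.tendsto 0
  have hne : ∀ z, ∀ᶠ a : ℝ in 𝓝[>] 0, y + a • z ≠ 0 := fun z =>
    (hcurve z).eventually_ne hy0
  have hcS : ∀ z, ∀ᶠ a : ℝ in 𝓝[>] 0, c z a ∈ sphere (0 : X) 1 := fun z => by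
    filter_upwards [hne z] with a ha
    simpa using norm_unitDir ha
  have hc : ∀ z, Tendsto (c z) (𝓝[>] 0) (𝓝 y) := fun z => by
    have := (continuousAt_unitDir hy0).tendsto.comp (hcurve z)
    rwa [unitDir_of_norm_eq_one hy₁] at this
  have hn := tendsto_norm_add_smul_of_suppFn_eq hy₁ hg
  have hp : ∀ z, Tendsto (p z) (𝓝[>] 0) (𝓝 (P z : X)) := fun z => by
    have hinv : Tendsto (fun a : ℝ => ‖y + a • z‖⁻¹) (𝓝[>] 0) (𝓝 1) := by
      simpa [hy₁] using (hcurve z).norm.inv₀ (by rw [hy₁]; norm_num)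
    have := hinv.smul ((tendsto_const_nhds (x := z)).sub ((hn z).smul_const y))
    rw [one_smul, ← hP] at this
    refine this.congr' ?_
    filter_upwards [hne z, self_mem_nhdsWithin] with a ha ha0
    have ha0 : a ≠ 0 := (show 0 < a from ha0).ne'
    have hna : ‖y + a • z‖ ≠ 0 := norm_ne_zero_iff.2 ha
    simp only [p, c, unitDir]
    match_scalars <;> field_simp
    ring
  have hqp : ∀ z, ∀ᶠ a : ℝ in 𝓝[>] 0, ‖p z a‖ = ‖q z a‖ := fun z => by
    filter_upwards [hcS z] with a ha
    simp only [p, q, norm_smul, hiso _ ha _ hy]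
  have hq : ∀ z (x : R), Tendsto (fun a => h x (q z a)) (𝓝[>] 0)
      (𝓝 (((L x : g.ker →ₗ[ℝ] ℝ) ∘ₗ P) z)) := fun z x => by
    refine (hh x).tendsto_apply_of_tendsto_inv_mul_norm ((hp z).norm.congr' (hqp z)) ?_
    refine ((hL x).tendsto_inv_mul_norm_add_smul_sub (hp z)).congr' ?_
    filter_upwards [hcS z, self_mem_nhdsWithin] with a ha ha0
    have ha0 : a ≠ 0 := (show 0 < a from ha0).ne'
    have h₁ : y - x + a • p z a = c z a - x := by
      simp only [p, smul_inv_smul₀ ha0]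
      abel
    have h₂ : f y - f x + a • q z a = f (c z a) - f x := by
      simp only [q, smul_inv_smul₀ ha0]
      abel
    rw [h₁, h₂, hiso _ ha _ x.1.2, hiso _ hy _ x.1.2]
  obtain ⟨T, hT⟩ := exists_linearMap_tendsto_of_separating h hsep _ q hq
  refine ⟨LinearMap.toContinuousLinearMap ((g : X →ₗ[ℝ] ℝ).smulRight (f y) + T), fun z => ?_⟩
  have hfc : Tendsto (fun a => f (c z a)) (𝓝[>] 0) (𝓝 (f y)) := by
    rw [tendsto_iff_norm_sub_tendsto_zero]
    refine (tendsto_iff_norm_sub_tendsto_zero.1 (hc z)).congr' ?_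
    filter_upwards [hcS z] with a ha
    rw [hiso _ ha _ hy]
  refine (((hn z).smul hfc).add (hT z)).congr fun a => ?_
  simp only [homExt, q, c, unitDir_of_norm_eq_one hy₁, hy₁]
  module
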